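/- (Theorem 4: optimality of the symmetric bang-bang schedule for a single spin-1/2.) Let 0 < t_f < π, let s : [0,t_f] → [0,1] be measurable, and let v : [0,t_f] → ℝ³ be absolutely continuous with v̇(t) = M(s(t)) v(t) almost everywhere and v(0) = (−1, 0, 0). Then the third component satisfies v₃(t_f) ≥ −sin²(t_f/2). Consequently, the minimum of the cost Tr(σ₃ρ(t_f)) = v₃(t_f) over all admissible controls equals −sin²(t_f/2) and is attained by the bang-bang control s ≡ 0 on [0, t_f/2] followed by s ≡ 1 on (t_f/2, t_f]. -/

import Mathlib

open MeasureTheory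

noncomputable section

namespace Stmt8

/-- The Bloch-equation generator `M(s)` for the spin-1/2 problem with driver `B = σx/2`
and target `C = σz/2`. -/
def M (s : ℝ) : Matrix (Fin 3) (Fin 3) ℝ :=
  !![0, -(1 - s), 0; 1 - s, 0, -s; 0, s, 0]

/-- `v` is an absolutely continuous solution of the controlled Bloch equation
`v̇(t) = M(s(t)) v(t)` on `[0, tf]` (integral form). -/
def IsBlochSol (tf : ℝ) (s : ℝ → ℝ) (v : ℝ → Fin 3 → ℝ) : Prop :=
  IntervalIntegrable (fun τ => (M (s τ)).mulVec (v τ)) volume 0 tf ∧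
  ∀ t ∈ Set.Icc (0 : ℝ) tf, v t = v 0 + ∫ τ in (0 : ℝ)..t, (M (s τ)).mulVec (v τ)

/-- The symmetric bang-bang control: `s ≡ 0` on `[0, tf/2]`, then `s ≡ 1`. -/
def sbb (tf : ℝ) (t : ℝ) : ℝ := if t ≤ tf / 2 then 0 else 1

/-- `f` is absolutely continuous on `[a, b]`, with derivative `f'` almost everywhere. -/
structure IsACPrimitive (f f' : ℝ → ℝ) (a b : ℝ) : Prop where
  ac : AbsolutelyContinuousOnInterval f a b
  deriv : ∀ᵐ t, t ∈ Set.Ioo a b → HasDerivAt f (f' t) t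

namespace IsACPrimitive

variable {f f' g g' : ℝ → ℝ} {a b : ℝ}

theorem of_hasDerivAt (hf : ContDiff ℝ 1 f) (hf' : ∀ t, HasDerivAt f (f' t) t) :
    IsACPrimitive f f' a b :=
  ⟨hf.contDiffOn.absolutelyContinuousOnInterval, .of_forall fun t _ => hf' t⟩

theorem congr_deriv (hf : IsACPrimitive f f' a b) (h : ∀ t, f' t = g' t) :
    IsACPrimitive f g' a b :=
  funext h ▸ hf

theorem mono (hf : IsACPrimitive f f' a b) {c d : ℝ} (hac : a ≤ c) (hcd : c ≤ d) (hdb : d ≤ b) :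
    IsACPrimitive f f' c d := by
  refine ⟨hf.ac.mono ?_, ?_⟩
  · rw [Set.uIcc_of_le hcd, Set.uIcc_of_le (hac.trans (hcd.trans hdb))]
    exact Set.Icc_subset_Icc hac hdb
  · filter_upwards [hf.deriv] with t ht h
    exact ht ⟨hac.trans_lt h.1, h.2.trans_le hdb⟩

theorem add (hf : IsACPrimitive f f' a b) (hg : IsACPrimitive g g' a b) :
    IsACPrimitive (fun t => f t + g t) (fun t => f' t + g' t) a b := by
  refine ⟨hf.ac.add hg.ac, ?_⟩
  filter_upwards [hf.deriv, hg.deriv] with t h1 h2 h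
  exact (h1 h).add (h2 h)

theorem neg (hf : IsACPrimitive f f' a b) :
    IsACPrimitive (fun t => -f t) (fun t => -f' t) a b := by
  refine ⟨hf.ac.neg, ?_⟩
  filter_upwards [hf.deriv] with t h1 h
  exact (h1 h).neg

theorem sub (hf : IsACPrimitive f f' a b) (hg : IsACPrimitive g g' a b) :
    IsACPrimitive (fun t => f t - g t) (fun t => f' t - g' t) a b := by
  refine ⟨hf.ac.sub hg.ac, ?_⟩
  filter_upwards [hf.deriv, hg.deriv] with t h1 h2 h
  exact (h1 h).sub (h2 h)

theorem mul (hf : IsACPrimitive f f' a b) (hg : IsACPrimitive g g' a b) :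
    IsACPrimitive (fun t => f t * g t) (fun t => f' t * g t + f t * g' t) a b := by
  refine ⟨hf.ac.mul hg.ac, ?_⟩
  filter_upwards [hf.deriv, hg.deriv] with t h1 h2 h
  exact (h1 h).mul (h2 h)

theorem const_mul (hf : IsACPrimitive f f' a b) (c : ℝ) :
    IsACPrimitive (fun t => c * f t) (fun t => c * f' t) a b := by
  refine ⟨hf.ac.const_mul c, ?_⟩
  filter_upwards [hf.deriv] with t h1 h
  exact (h1 h).const_mul c

theorem comp {φ φ' : ℝ → ℝ} {S : Set ℝ} {K : NNReal} (hf : IsACPrimitive f f' a b) (hab : a ≤ b)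
    (hS : Set.MapsTo f (Set.Icc a b) S) (hφ : LipschitzOnWith K φ S)
    (hφ' : ∀ x ∈ S, HasDerivAt φ (φ' x) x) :
    IsACPrimitive (fun t => φ (f t)) (fun t => φ' (f t) * f' t) a b := by
  constructor
  · refine squeeze_zero' (.of_forall fun E => Finset.sum_nonneg fun i _ => dist_nonneg) ?_
      (by simpa using Filter.Tendsto.const_mul (K : ℝ) hf.ac)
    filter_upwards [Filter.mem_inf_of_right (Filter.mem_principal_self _)] with E hE
    rw [Finset.mul_sum]
    refine Finset.sum_le_sum fun i hi => ?_
    have h := hE.1 i hi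
    rw [Set.uIcc_of_le hab] at h
    exact hφ.dist_le_mul _ (hS h.1) _ (hS h.2)
  · filter_upwards [hf.deriv] with t h1 h
    exact (hφ' _ (hS ⟨h.1.le, h.2.le⟩)).comp t (h1 h)

theorem sin (hf : IsACPrimitive f f' a b) (hab : a ≤ b) :
    IsACPrimitive (fun t => Real.sin (f t)) (fun t => Real.cos (f t) * f' t) a b :=
  hf.comp hab (Set.mapsTo_univ _ _) Real.lipschitzWith_sin.lipschitzOnWith
    fun x _ => Real.hasDerivAt_sin x

theorem cos (hf : IsACPrimitive f f' a b) (hab : a ≤ b) :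
    IsACPrimitive (fun t => Real.cos (f t)) (fun t => -Real.sin (f t) * f' t) a b :=
  hf.comp hab (Set.mapsTo_univ _ _) Real.lipschitzWith_cos.lipschitzOnWith
    fun x _ => Real.hasDerivAt_cos x

theorem le_of_deriv_nonpos (hf : IsACPrimitive f f' a b) (hab : a ≤ b)
    (h : ∀ t ∈ Set.Ioo a b, f' t ≤ 0) : f b ≤ f a := by
  rw [← sub_nonpos, ← hf.ac.integral_deriv_eq_sub, intervalIntegral.integral_of_le hab,
    integral_Ioc_eq_integral_Ioo]
  refine integral_nonpos_of_ae ?_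
  rw [Filter.EventuallyLE, ae_restrict_iff' measurableSet_Ioo]
  filter_upwards [hf.deriv] with t h1 ht
  simpa [(h1 ht).deriv] using h t ht

/-- If `f' = γ h` with `γ ≥ 0` and `f ^ 2 + h ^ 2 ≤ 1`, then `arcsin f` grows at rate at
most `γ`. -/
theorem arcsin_sub_le {γ Γ h : ℝ → ℝ} (hf : IsACPrimitive f (fun t => γ t * h t) a b)
    (hΓ : IsACPrimitive Γ γ a b) (hab : a ≤ b) (hγ : ∀ t ∈ Set.Ioo a b, 0 ≤ γ t)
    (hfh : ∀ t ∈ Set.Icc a b, f t ^ 2 + h t ^ 2 ≤ 1) :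
    Real.arcsin (f b) - Real.arcsin (f a) ≤ Γ b - Γ a := by
  have key : ∀ κ ∈ Set.Ioo (0 : ℝ) 1,
      Real.arcsin (κ * f b) - Real.arcsin (κ * f a) ≤ Γ b - Γ a := by
    intro κ ⟨hκ0, hκ1⟩
    have hne : ∀ x ∈ Set.Icc (-κ) κ, x ≠ -1 ∧ x ≠ 1 := fun x hx =>
      ⟨by linarith [hx.1] |> ne_of_gt, by linarith [hx.2] |> ne_of_lt⟩
    have hcd : ContDiffOn ℝ 1 Real.arcsin (Set.Icc (-κ) κ) := fun x hx =>
      (Real.contDiffAt_arcsin (hne x hx).1 (hne x hx).2).contDiffWithinAt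
    obtain ⟨K, hK⟩ :=
      hcd.exists_lipschitzOnWith (by decide) (convex_Icc _ _) isCompact_Icc
    have hmaps : Set.MapsTo (fun t => κ * f t) (Set.Icc a b) (Set.Icc (-κ) κ) := by
      intro t ht
      have := abs_le.1 (abs_le_one_iff_mul_self_le_one.2
        (by nlinarith [hfh t ht, sq_nonneg (h t)] : f t * f t ≤ 1))
      constructor <;> nlinarith [this.1, this.2]
    have hg := ((hf.const_mul κ).comp hab hmaps hK fun x hx =>
      Real.hasDerivAt_arcsin (hne x hx).1 (hne x hx).2).sub hΓ
    have := hg.le_of_deriv_nonpos hab fun t ht => by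
      have h1 := hfh t ⟨ht.1.le, ht.2.le⟩
      have hlt : 0 < 1 - (κ * f t) ^ 2 := by
        nlinarith [sq_nonneg (h t), sq_nonneg (f t), mul_pos hκ0 (sub_pos.2 hκ1)]
      have hle : κ * h t ≤ √(1 - (κ * f t) ^ 2) := by
        apply Real.le_sqrt_of_sq_le
        nlinarith [mul_le_mul_of_nonneg_left h1 (sq_nonneg κ)]
      have hdiv : κ * h t / √(1 - (κ * f t) ^ 2) ≤ 1 :=
        (div_le_one (Real.sqrt_pos.2 hlt)).2 hle
      have := mul_le_mul_of_nonneg_left hdiv (hγ t ht)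
      calc _ = γ t * (κ * h t / √(1 - (κ * f t) ^ 2)) - γ t := by ring
        _ ≤ 0 := by linarith
    linarith
  have hlim : Filter.Tendsto (fun κ : ℝ => Real.arcsin (κ * f b) - Real.arcsin (κ * f a))
      (nhdsWithin 1 (Set.Iio 1)) (nhds (Real.arcsin (f b) - Real.arcsin (f a))) := by
    have : Continuous fun κ : ℝ => Real.arcsin (κ * f b) - Real.arcsin (κ * f a) := by fun_prop
    simpa using (this.tendsto 1).mono_left nhdsWithin_le_nhds
  exact le_of_tendsto hlim
    (Filter.eventually_of_mem (Ioo_mem_nhdsLT zero_lt_one) key)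

theorem of_eq_integral (hab : a ≤ b) (hi : IntervalIntegrable f' volume a b)
    (hf : ∀ t ∈ Set.Icc a b, f t = f a + ∫ τ in a..t, f' τ) : IsACPrimitive f f' a b := by
  have hprim : IsACPrimitive (fun t => f a + ∫ τ in a..t, f' τ) f' a b := by
    constructor
    · exact (contDiffOn_const (c := f a)).absolutelyContinuousOnInterval.add
        (hi.absolutelyContinuousOnInterval_intervalIntegral Set.left_mem_uIcc)
    · filter_upwards [hi.ae_hasDerivAt_integral] with t ht h
      refine (ht ?_ a Set.left_mem_uIcc).const_add _
      rw [Set.uIcc_of_le hab]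
      exact ⟨h.1.le, h.2.le⟩
  constructor
  · refine hprim.ac.congr' ?_
    filter_upwards [Filter.mem_inf_of_right (Filter.mem_principal_self _)] with E hE
    refine Finset.sum_congr rfl fun i hi => ?_
    have h := hE.1 i hi
    rw [Set.uIcc_of_le hab] at h
    rw [hf _ h.1, hf _ h.2]
  · filter_upwards [hprim.deriv] with t ht h
    refine (ht h).congr_of_eventuallyEq ?_
    filter_upwards [Ioo_mem_nhds h.1 h.2] with u hu
    exact hf u ⟨hu.1.le, hu.2.le⟩

end IsACPrimitive

/-- The height reached on the unit ball by a trajectory starting at the first basis vector and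
rotated about the third and first axes at rates `1 - s` and `s`. -/
theorem height_le {T : ℝ} (h0 : 0 ≤ T) (hπ : T < Real.pi) {s x y z β : ℝ → ℝ}
    (hs : ∀ t ∈ Set.Ioo 0 T, s t ∈ Set.Icc (0 : ℝ) 1)
    (hx : IsACPrimitive x (fun t => -((1 - s t) * y t)) 0 T)
    (hy : IsACPrimitive y (fun t => (1 - s t) * x t - s t * z t) 0 T)
    (hz : IsACPrimitive z (fun t => s t * y t) 0 T)
    (hβ : IsACPrimitive β s 0 T)
    (hx0 : x 0 = 1) (hy0 : y 0 = 0) (hz0 : z 0 = 0) (hβ0 : β 0 = 0) :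
    z T ≤ Real.sin (T / 2) ^ 2 := by
  have hα : IsACPrimitive (fun t => t - β t) (fun t => 1 - s t) 0 T :=
    (IsACPrimitive.of_hasDerivAt contDiff_id fun t => hasDerivAt_id t).sub hβ
  have hβmono : ∀ t u, 0 ≤ t → t ≤ u → u ≤ T → β t ≤ β u := fun t u ht htu hu => by
    have := (hβ.mono ht htu hu).neg.le_of_deriv_nonpos htu fun r hr => by
      linarith [(hs r ⟨ht.trans_lt hr.1, hr.2.trans_le hu⟩).1]
    linarith
  have hαmono : ∀ t u, 0 ≤ t → t ≤ u → u ≤ T → t - β t ≤ u - β u := fun t u ht htu hu => by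
    have := (hα.mono ht htu hu).neg.le_of_deriv_nonpos htu fun r hr => by
      linarith [(hs r ⟨ht.trans_lt hr.1, hr.2.trans_le hu⟩).2]
    linarith
  have hball : ∀ t ∈ Set.Icc 0 T, x t ^ 2 + y t ^ 2 + z t ^ 2 ≤ 1 := fun t ht => by
    have := (((hx.mul hx).add (hy.mul hy)).add (hz.mul hz)).mono le_rfl ht.1 ht.2
      |>.le_of_deriv_nonpos ht.1 fun r _ => le_of_eq (by ring)
    simp only [hx0, hy0, hz0] at this
    linarith
  have hxcos : ∀ t ∈ Set.Icc 0 T, Real.cos (t - β t) ≤ x t := fun t ht => by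
    have hα0 := hαmono 0 t le_rfl ht.1 ht.2
    have hβ1 := hβmono 0 t le_rfl ht.1 ht.2
    have := ((hx.neg.congr_deriv fun r => neg_neg _).mono le_rfl ht.1 ht.2).arcsin_sub_le
      (hα.mono le_rfl ht.1 ht.2) ht.1
      (fun r hr => by linarith [(hs r ⟨hr.1, hr.2.trans_le ht.2⟩).2])
      (fun r hr => by nlinarith [hball r ⟨hr.1, hr.2.trans ht.2⟩, sq_nonneg (z r)])
    rw [hx0, hβ0, Real.arcsin_neg_one] at this
    have h2 := (Real.arcsin_le_iff_le_sin' (x := -x t) (y := (t - β t) - Real.pi / 2)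
      ⟨by linarith, by linarith [ht.2]⟩).1 (by linarith)
    rw [Real.sin_sub_pi_div_two] at h2
    linarith
  have hT : T ∈ Set.Icc 0 T := ⟨h0, le_rfl⟩
  have hβT := hβmono 0 T le_rfl h0 le_rfl
  have hαT := hαmono 0 T le_rfl h0 le_rfl
  rw [hβ0] at hβT hαT
  rw [Real.sin_sq_eq_half_sub, mul_div_cancel₀ _ (two_ne_zero' ℝ)]
  have hlate : ∀ θ, 0 ≤ θ → θ ≤ T - Real.pi / 2 → Real.sin θ ≤ 1 / 2 - Real.cos T / 2 :=
    fun θ hθ0 hθ => by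
      have := Real.sin_le_sin_of_le_of_le_pi_div_two (by linarith [Real.pi_pos])
        (by linarith) hθ
      rw [Real.sin_sub_pi_div_two] at this
      linarith [Real.neg_one_le_cos T]
  rcases le_or_gt (T - β T) (Real.pi / 2) with hA | hA
  · have hyz : y T ^ 2 + z T ^ 2 ≤ Real.sin (T - β T) ^ 2 := by
      have hc : 0 ≤ Real.cos (T - β T) :=
        Real.cos_nonneg_of_neg_pi_div_two_le_of_le (by linarith [Real.pi_pos]) hA
      nlinarith [hball T hT, hxcos T hT, Real.sin_sq_add_cos_sq (T - β T)]
    have hs0 : 0 ≤ Real.sin (T - β T) :=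
      Real.sin_nonneg_of_nonneg_of_le_pi (by linarith) (by linarith)
    rcases le_or_gt (β T) (Real.pi / 2) with hB | hB
    · have hg := ((hz.mul (hβ.cos h0)).sub (hy.mul (hβ.sin h0))).le_of_deriv_nonpos h0
        fun t ht => by
          have htI : t ∈ Set.Icc 0 T := ⟨ht.1.le, ht.2.le⟩
          have h1 := hβmono 0 t le_rfl ht.1.le ht.2.le
          have h2 := hβmono t T ht.1.le ht.2.le le_rfl
          have h3 := hαmono 0 t le_rfl ht.1.le ht.2.le
          have h4 := hαmono t T ht.1.le ht.2.le le_rfl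
          rw [hβ0] at h1 h3
          have hxt : 0 ≤ x t := (Real.cos_nonneg_of_neg_pi_div_two_le_of_le
            (by linarith [Real.pi_pos]) (by linarith)).trans (hxcos t htI)
          have hsin : 0 ≤ Real.sin (β t) :=
            Real.sin_nonneg_of_nonneg_of_le_pi h1 (by linarith [Real.pi_pos])
          have := mul_nonneg (mul_nonneg (sub_nonneg.2 (hs t ht).2) hxt) hsin
          linarith
      simp only [hy0, hz0, zero_mul, sub_zero] at hg
      have hcB : 0 ≤ Real.cos (β T) :=
        Real.cos_nonneg_of_neg_pi_div_two_le_of_le (by linarith [Real.pi_pos]) hB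
      have hsB : 0 ≤ Real.sin (β T) :=
        Real.sin_nonneg_of_nonneg_of_le_pi hβT (by linarith [Real.pi_pos])
      have hsc := Real.sin_sq_add_cos_sq (β T)
      have hh : z T * Real.sin (β T) + y T * Real.cos (β T) ≤ Real.sin (T - β T) := by
        refine le_of_sq_le_sq ?_ hs0
        nlinarith [sq_nonneg (z T * Real.cos (β T) - y T * Real.sin (β T))]
      have hzT : z T ≤ Real.sin (T - β T) * Real.sin (β T) := by
        have e : z T = (z T * Real.cos (β T) - y T * Real.sin (β T)) * Real.cos (β T) +
            (z T * Real.sin (β T) + y T * Real.cos (β T)) * Real.sin (β T) := by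
          linear_combination (-z T) * hsc
        nlinarith [mul_nonneg (neg_nonneg.2 hg) hcB, mul_le_mul_of_nonneg_right hh hsB]
      have hsum := Real.cos_add (T - β T) (β T)
      have hdiff := Real.cos_sub (T - β T) (β T)
      rw [sub_add_cancel] at hsum
      linarith [Real.cos_le_one (T - β T - β T)]
    · refine (le_of_sq_le_sq ?_ hs0).trans (hlate _ (by linarith) (by linarith))
      linarith [sq_nonneg (y T)]
  · have := hz.arcsin_sub_le hβ h0 (fun r hr => (hs r hr).1)
      (fun r hr => by linarith [hball r hr, sq_nonneg (x r)])
    rw [hz0, hβ0, Real.arcsin_zero] at this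
    have h2 := (Real.arcsin_le_iff_le_sin' (x := z T) (y := β T)
      ⟨by linarith [Real.pi_pos], by linarith⟩).1 (by linarith)
    exact h2.trans (hlate _ hβT (by linarith))

theorem M_mulVec (r : ℝ) (u : Fin 3 → ℝ) :
    (M r).mulVec u = ![-((1 - r) * u 1), (1 - r) * u 0 - r * u 2, r * u 1] := by
  ext i
  fin_cases i <;> simp [M, Matrix.mulVec, dotProduct, Fin.sum_univ_three] <;> ring

theorem IsBlochSol.isACPrimitive_apply {tf : ℝ} (h0 : 0 ≤ tf) {s : ℝ → ℝ} {v : ℝ → Fin 3 → ℝ}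
    (hv : IsBlochSol tf s v) (i : Fin 3) :
    IsACPrimitive (fun t => v t i) (fun t => (M (s t)).mulVec (v t) i) 0 tf := by
  let L : (Fin 3 → ℝ) →L[ℝ] ℝ := ContinuousLinearMap.proj i
  have hi := hv.1
  have hint : ∀ t ∈ Set.Icc 0 tf,
      IntervalIntegrable (fun τ => (M (s τ)).mulVec (v τ)) volume 0 t := fun t ht => by
    refine hi.mono_set ?_
    rw [Set.uIcc_of_le ht.1, Set.uIcc_of_le h0]
    exact Set.Icc_subset_Icc_right ht.2
  refine .of_eq_integral h0 ?_ fun t ht => ?_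
  · exact ⟨L.integrable_comp hi.1, L.integrable_comp hi.2⟩
  · have := congrArg L (hv.2 t ht)
    rw [map_add, ← L.intervalIntegral_comp_comm (hint t ht)] at this
    exact this

theorem IsBlochSol.neg_sin_sq_le {tf : ℝ} (h0 : 0 ≤ tf) (hπ : tf < Real.pi) {s : ℝ → ℝ}
    (hs : Measurable s) (hsval : ∀ t ∈ Set.Icc (0 : ℝ) tf, s t ∈ Set.Icc (0 : ℝ) 1)
    {v : ℝ → Fin 3 → ℝ} (hv : IsBlochSol tf s v) (hv0 : v 0 = ![-1, 0, 0]) :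
    -(Real.sin (tf / 2)) ^ 2 ≤ v tf 2 := by
  have hsint : IntervalIntegrable s volume 0 tf := by
    rw [intervalIntegrable_iff_integrableOn_Icc_of_le h0]
    refine Measure.integrableOn_of_bounded (M := 1) (by simp) hs.aestronglyMeasurable ?_
    refine (ae_restrict_iff' measurableSet_Icc).2 (.of_forall fun t ht => ?_)
    rw [Real.norm_eq_abs, abs_le]
    exact ⟨by linarith [(hsval t ht).1], (hsval t ht).2⟩
  have hβ : IsACPrimitive (fun t => ∫ τ in (0 : ℝ)..t, s τ) s 0 tf :=
    .of_eq_integral h0 hsint fun t _ => by simp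
  have hc := hv.isACPrimitive_apply h0
  have := height_le h0 hπ (x := fun t => -v t 0) (y := fun t => -v t 1) (z := fun t => -v t 2)
    (fun t ht => hsval t ⟨ht.1.le, ht.2.le⟩)
    ((hc 0).neg.congr_deriv fun t => by simp [M_mulVec])
    ((hc 1).neg.congr_deriv fun t => by simp [M_mulVec]; ring)
    ((hc 2).neg.congr_deriv fun t => by simp [M_mulVec])
    hβ (by simp [hv0]) (by simp [hv0]) (by simp [hv0]) (by simp)
  linarith

/-- The trajectory of the symmetric bang-bang control. -/
def bangBangSol (tf t : ℝ) : Fin 3 → ℝ :=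
  ![-Real.cos (min t (tf / 2)),
    -(Real.sin (min t (tf / 2)) * Real.cos (max (t - tf / 2) 0)),
    -(Real.sin (min t (tf / 2)) * Real.sin (max (t - tf / 2) 0))]

theorem continuous_bangBangSol (tf : ℝ) : Continuous (bangBangSol tf) := by
  refine continuous_pi fun i => ?_
  fin_cases i <;> simp [bangBangSol] <;> fun_prop

theorem hasDerivAt_bangBangSol {tf t : ℝ} (ht : t ≠ tf / 2) :
    HasDerivAt (bangBangSol tf) ((M (sbb tf t)).mulVec (bangBangSol tf t)) t := by
  rcases lt_or_gt_of_ne ht with h | h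
  · have hev : bangBangSol tf =ᶠ[nhds t] fun u => ![-Real.cos u, -Real.sin u, 0] := by
      filter_upwards [Iio_mem_nhds h] with u hu
      have hu : u < tf / 2 := hu
      simp [bangBangSol, min_eq_left hu.le, max_eq_right (sub_nonpos.2 hu.le)]
    refine HasDerivAt.congr_of_eventuallyEq ?_ hev
    rw [hev.eq_of_nhds, M_mulVec, sbb, if_pos h.le, hasDerivAt_pi]
    intro i
    fin_cases i
    · simpa using (Real.hasDerivAt_cos t).fun_neg
    · simpa using (Real.hasDerivAt_sin t).fun_neg
    · simpa using hasDerivAt_const t (0 : ℝ)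
  · have hev : bangBangSol tf =ᶠ[nhds t] fun u => ![-Real.cos (tf / 2),
        -(Real.sin (tf / 2) * Real.cos (u - tf / 2)),
        -(Real.sin (tf / 2) * Real.sin (u - tf / 2))] := by
      filter_upwards [Ioi_mem_nhds h] with u hu
      have hu : tf / 2 < u := hu
      simp [bangBangSol, min_eq_right hu.le, max_eq_left (sub_nonneg.2 hu.le)]
    refine HasDerivAt.congr_of_eventuallyEq ?_ hev
    rw [hev.eq_of_nhds, M_mulVec, sbb, if_neg h.not_ge, hasDerivAt_pi]
    have hid := (hasDerivAt_id t).sub_const (tf / 2)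
    intro i
    fin_cases i
    · simpa using hasDerivAt_const t (-Real.cos (tf / 2))
    · simpa using (hid.cos.const_mul (Real.sin (tf / 2))).fun_neg
    · simpa using (hid.sin.const_mul (Real.sin (tf / 2))).fun_neg

theorem isBlochSol_bangBangSol (tf : ℝ) :
    IsBlochSol tf (sbb tf) (bangBangSol tf) := by
  have hcont : ∀ r : ℝ, Continuous fun τ => (M r).mulVec (bangBangSol tf τ) := fun r =>
    (continuous_const (y := M r)).matrix_mulVec (continuous_bangBangSol tf)
  have hint : ∀ a b, IntervalIntegrable
      (fun τ => (M (sbb tf τ)).mulVec (bangBangSol tf τ)) volume a b := by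
    intro a b
    have he : (fun τ => (M (sbb tf τ)).mulVec (bangBangSol tf τ)) =
        (Set.Iic (tf / 2)).piecewise (fun τ => (M 0).mulVec (bangBangSol tf τ))
          (fun τ => (M 1).mulVec (bangBangSol tf τ)) := by
      funext τ
      by_cases h : τ ≤ tf / 2 <;> simp [sbb, Set.piecewise, h]
    rw [he, intervalIntegrable_iff]
    refine Integrable.piecewise measurableSet_Iic ?_ ?_
    · exact (intervalIntegrable_iff.1 ((hcont 0).intervalIntegrable a b)).integrableOn
    · exact (intervalIntegrable_iff.1 ((hcont 1).intervalIntegrable a b)).integrableOn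
  refine ⟨hint 0 tf, fun t ht => ?_⟩
  rw [integral_eq_of_hasDerivAt_off_countable_of_le _ _ ht.1
    (Set.countable_singleton (tf / 2)) (continuous_bangBangSol tf).continuousOn
    (fun u hu => hasDerivAt_bangBangSol hu.2) (hint 0 t), add_sub_cancel]

/-- **Theorem 4**: for `0 < tf < π`, every admissible Bloch trajectory starting from the
ground state `(−1,0,0)` of `B` satisfies `v₃(tf) ≥ −sin²(tf/2)`; the minimum `−sin²(tf/2)`
is attained by the symmetric bang-bang control. -/
theorem spin_half_bang_bang_optimal
    (tf : ℝ) (h0 : 0 < tf) (hπ : tf < Real.pi)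
    (s : ℝ → ℝ) (hs : Measurable s) (hsval : ∀ t ∈ Set.Icc (0 : ℝ) tf, s t ∈ Set.Icc (0 : ℝ) 1)
    (v : ℝ → Fin 3 → ℝ) (hv : IsBlochSol tf s v) (hv0 : v 0 = ![-1, 0, 0]) :
    -(Real.sin (tf / 2)) ^ 2 ≤ v tf 2 ∧
    ∃ w : ℝ → Fin 3 → ℝ, IsBlochSol tf (sbb tf) w ∧ w 0 = ![-1, 0, 0] ∧
      w tf 2 = -(Real.sin (tf / 2)) ^ 2 := by
  refine ⟨hv.neg_sin_sq_le h0.le hπ hs hsval hv0, bangBangSol tf,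
    isBlochSol_bangBangSol tf, ?_, ?_⟩
  · have h1 : min 0 (tf / 2) = 0 := min_eq_left (by linarith)
    simp [bangBangSol, h1]
  · have h1 : min tf (tf / 2) = tf / 2 := min_eq_right (by linarith)
    have h2 : max (tf - tf / 2) 0 = tf / 2 := by rw [sub_half]; exact max_eq_left (by linarith)
    simp [bangBangSol, h1, h2, sq]

end Stmt8
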